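/- arXiv:2106.04777 — 2 statements merged into one kernel-verified Lean document; each statement's English description precedes it below -/
import Mathlib

section
/- Let N = 128 and r = 4. Let φ_m be a left-toggle radius-4 local rule and let φ_b be a radius-4 local rule for which there exists g : Bool → Bool with g = id or g = not such that φ_b(v) = g(v(0)) for every neighborhood v (i.e., φ_b either always copies or always complements the leftmost input bit). Then for every configuration s : ZMod 128 → Bool there exists one and only one configuration t : ZMod 128 → Bool with Φ(t) = s, where Φ is the hybrid global map determined by φ_m and φ_b. -/
/-- The radius-`r` neighborhood of cell `i` in configuration `s` on a cyclic
lattice of `N` cells: position `j` holds the value of cell `i + j - r`. -/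
def nbhd (N r : ℕ) (s : ZMod N → Bool) (i : ZMod N) : Fin (2*r+1) → Bool :=
  fun j => s (i + ((j : ℕ) : ZMod N) - ((r : ℕ) : ZMod N))

/-- A radius-`r` local rule is left-toggle if two neighborhoods agreeing
everywhere except at position 0 (the leftmost cell) get different outputs. -/
def LeftToggle (r : ℕ) (f : (Fin (2*r+1) → Bool) → Bool) : Prop :=
  ∀ v w : Fin (2*r+1) → Bool,
    (∀ j, j ≠ 0 → v j = w j) → v 0 ≠ w 0 → f v ≠ f w

/-- A radius-`r` local rule is right-toggle if two neighborhoods agreeing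
everywhere except at position `2r` (the rightmost cell) get different outputs. -/
def RightToggle (r : ℕ) (f : (Fin (2*r+1) → Bool) → Bool) : Prop :=
  ∀ v w : Fin (2*r+1) → Bool,
    (∀ j, j ≠ Fin.last (2*r) → v j = w j) →
      v (Fin.last (2*r)) ≠ w (Fin.last (2*r)) → f v ≠ f w

/-- The hybrid global map: cells `0, …, 2r-1` (the border) are updated with
the border rule `φb`, all other cells with the main rule `φm`. -/
def hybrid (N r : ℕ) (φm φb : (Fin (2*r+1) → Bool) → Bool)
    (s : ZMod N → Bool) : ZMod N → Bool :=
  fun i => if i.val < 2*r then φb (nbhd N r s i) else φm (nbhd N r s i)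

lemma nbhd_zero (N r : ℕ) (s : ZMod N → Bool) (i : ZMod N) :
    nbhd N r s i 0 = s (i - (r : ZMod N)) := by
  simp [nbhd]

/-- A hybrid map whose main rule is left-toggle and whose border rule applies an injective
function to the leftmost input bit is injective. -/
theorem hybrid_injective {N r : ℕ} [NeZero N] {φm φb : (Fin (2*r+1) → Bool) → Bool}
    (hm : LeftToggle r φm) {g : Bool → Bool} (hg : Function.Injective g)
    (hb : ∀ v, φb v = g (v 0)) : Function.Injective (hybrid N r φm φb) := by
  intro t u htu
  have border (i : ZMod N) (hi : i.val < 2 * r) : t (i - r) = u (i - r) := by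
    have h := congrFun htu i
    simp only [hybrid, if_pos hi, hb, nbhd_zero] at h
    exact hg h
  have descend (k : ℕ) : ∀ i : ZMod N, N - i.val = k → t (i - r) = u (i - r) := by
    induction k using Nat.strong_induction_on with
    | _ k ih =>
      intro i hik
      by_cases hi : i.val < 2 * r
      · exact border i hi
      by_contra hne
      have h := congrFun htu i
      simp only [hybrid, if_neg hi] at h
      refine hm _ _ (fun j hj => ?_) (by simpa only [nbhd_zero] using hne) h
      have hj0 : (j : ℕ) ≠ 0 := fun h0 => hj (Fin.ext h0)
      have hj2 := j.isLt
      have hiN := i.val_lt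
      have hval : (i + ((j : ℕ) : ZMod N)).val = (i.val + j) % N := by
        rw [ZMod.val_add, ZMod.val_natCast, Nat.add_mod_mod]
      rcases lt_or_ge (i.val + j) N with hlt | hge
      · rw [Nat.mod_eq_of_lt hlt] at hval
        exact ih _ (by omega) _ rfl
      · rw [Nat.mod_eq_sub_mod hge] at hval
        have := Nat.mod_le (i.val + j - N) N
        exact border _ (by omega)
  funext x
  simpa using descend _ (x + r) rfl

/-- Theorem 1 of the paper, HCA reversibility for `N = 128`,
`r = 4`: if the main rule is left-toggle and the border rule always copies or
always complements the leftmost input bit, then every configuration has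
exactly one pre-image under the hybrid global map. -/
theorem hca_unique_preimage_128
    (φm φb : (Fin (2*4+1) → Bool) → Bool)
    (hm : LeftToggle 4 φm)
    (g : Bool → Bool) (hg : g = id ∨ g = not)
    (hb : ∀ v : Fin (2*4+1) → Bool, φb v = g (v 0)) :
    ∀ s : ZMod 128 → Bool, ∃! t : ZMod 128 → Bool, hybrid 128 4 φm φb t = s := by
  have hginj : Function.Injective g := by
    rcases hg with rfl | rfl
    · exact Function.injective_id
    · exact Bool.not_injective
  exact (Finite.injective_iff_bijective.mp (hybrid_injective hm hginj hb)).existsUnique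
end

section
/- Let r ≥ 1 and N ≥ 2r + 1. Let φ_m be a right-toggle radius-r local rule and let φ_b be a radius-r local rule for which there exists g : Bool → Bool with g = id or g = not such that φ_b(v) = g(v(2r)) for every neighborhood v (i.e., φ_b either always copies or always complements the rightmost input bit). Then the hybrid global map Φ determined by φ_m and φ_b is bijective on configurations ZMod N → Bool: every configuration has exactly one pre-image under Φ. -/
/-- for `r ≥ 1` and `N ≥ 2r+1`, with a right-toggle main rule
and a border rule that always copies or always complements the rightmost input
bit, the hybrid global map is bijective (exactly one pre-image). -/
theorem hca_bijective_right
    (r N : ℕ) (hr : 1 ≤ r) (hN : 2*r+1 ≤ N)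
    (φm φb : (Fin (2*r+1) → Bool) → Bool)
    (hm : RightToggle r φm)
    (g : Bool → Bool) (hg : g = id ∨ g = not)
    (hb : ∀ v : Fin (2*r+1) → Bool, φb v = g (v (Fin.last (2*r)))) :
    Function.Bijective (hybrid N r φm φb) := by
  have hgi : Function.Injective g := by
    rcases hg with rfl | rfl
    · exact Function.injective_id
    · exact Bool.not_injective
  have : NeZero N := ⟨by omega⟩
  have nbhd_last (s : ZMod N → Bool) (k : ℕ) :
      nbhd N r s (k : ZMod N) (Fin.last (2*r)) = s ((k + r : ℕ) : ZMod N) := by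
    simp only [nbhd, Fin.val_last]
    congr 1
    push_cast
    ring
  refine Finite.injective_iff_bijective.mp fun s t hst => ?_
  have agree (k : ℕ) (hk : k < N) : s ((k + r : ℕ) : ZMod N) = t ((k + r : ℕ) : ZMod N) := by
    induction k using Nat.strong_induction_on with
    | _ k ih =>
      have hcell := congrFun hst (k : ZMod N)
      simp only [hybrid, ZMod.val_cast_of_lt hk] at hcell
      split_ifs at hcell with hborder
      · simpa only [hb, nbhd_last, hgi.eq_iff] using hcell
      · by_contra hne
        refine hm _ _ (fun j hj => ?_) (by simpa only [nbhd_last] using hne) hcell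
        have hj' : (j : ℕ) < 2 * r := Fin.val_lt_last hj
        have hpos : (k : ZMod N) + ((j : ℕ) : ZMod N) - (r : ZMod N)
            = ((k + j - 2 * r + r : ℕ) : ZMod N) := by
          rw [sub_eq_iff_eq_add]
          norm_cast
          congr 1
          omega
        simpa only [nbhd, hpos] using ih (k + j - 2 * r) (by omega) (by omega)
  funext x
  simpa using agree (x - r).val (ZMod.val_lt _)
end
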